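/- Let n ≥ 2 and let R_1 : S_n → GL(V_1) and R_2 : S_n → GL(V_2) be two absolutely irreducible finite-dimensional representations of S_n over k with dim V_1 ≥ 2 and dim V_2 ≥ 2 (absolutely irreducible meaning: nonzero, irreducible, and every linear endomorphism commuting with the action is a scalar multiple of the identity). If there exists a linear isomorphism P : V_1 → V_2 such that P ∘ R_1(x) = R_2(x) ∘ P for every x in the derived Lie subalgebra g'_n (where R_i is extended k-linearly to k[S_n]), then the same P satisfies P ∘ R_1(s) = R_2(s) ∘ P for every s ∈ S_n; in particular R_1 and R_2 are isomorphic as representations of S_n. -/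

import Mathlib

open MonoidAlgebra in
/-- The set of transpositions `(i j)` inside the group algebra `k[S_n]`. -/
def transpositions (k : Type) [Field k] (n : ℕ) : Set (MonoidAlgebra k (Equiv.Perm (Fin n))) :=
  {x | ∃ i j : Fin n, i ≠ j ∧ x = MonoidAlgebra.of k (Equiv.Perm (Fin n)) (Equiv.swap i j)}

attribute [local instance 100] LieRing.ofAssociativeRing

/-- `g_n`: the Lie subalgebra of the group algebra `k[S_n]` (with the commutator
bracket `⁅a, b⁆ = a * b - b * a`) generated by the transpositions. -/
noncomputable def gn (k : Type) [Field k] (n : ℕ) : LieSubalgebra k (MonoidAlgebra k (Equiv.Perm (Fin n))) :=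
  LieSubalgebra.lieSpan k (MonoidAlgebra k (Equiv.Perm (Fin n))) (transpositions k n)

/-- `g'_n = [g_n, g_n]`: the derived subalgebra of `g_n`, the span of all brackets
of elements of `g_n`. -/
noncomputable def gnDer (k : Type) [Field k] (n : ℕ) : Submodule k (MonoidAlgebra k (Equiv.Perm (Fin n))) :=
  Submodule.span k {x | ∃ a ∈ gn k n, ∃ b ∈ gn k n, x = ⁅a, b⁆}

/-- `T_n`: the sum of all transpositions in `k[S_n]`. -/
noncomputable def sumTranspositions (k : Type) [Field k] (n : ℕ) :
    MonoidAlgebra k (Equiv.Perm (Fin n)) :=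
  ∑ p ∈ Finset.univ.filter (fun p : Fin n × Fin n => p.1 < p.2),
    MonoidAlgebra.of k (Equiv.Perm (Fin n)) (Equiv.swap p.1 p.2)

/-- A representation is absolutely irreducible: nonzero, irreducible, and every
linear endomorphism commuting with the action is a scalar multiple of the
identity. -/
def AbsolutelyIrreducible {k V G : Type} [Field k] [AddCommGroup V] [Module k V]
    [Group G] (R : Representation k G V) : Prop :=
  (∃ v : V, v ≠ 0) ∧
  (∀ W : Submodule k V, (∀ g : G, ∀ w ∈ W, R g w ∈ W) → W = ⊥ ∨ W = ⊤) ∧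
  (∀ f : V →ₗ[k] V, (∀ g : G, f ∘ₗ R g = R g ∘ₗ f) →
    ∃ c : k, f = c • (LinearMap.id : V →ₗ[k] V))

theorem aux_der (k : Type) [Field k] [CharZero k] (n : ℕ) (a b : Fin n) (hab : a ≠ b)
    (g : Equiv.Perm (Fin n)) :
    MonoidAlgebra.of k (Equiv.Perm (Fin n)) (Equiv.swap a b) -
      MonoidAlgebra.of k (Equiv.Perm (Fin n)) (g * Equiv.swap a b * g⁻¹) ∈ gnDer k n := by
  induction g using Equiv.Perm.swap_induction_on with
  | one => simp
  | swap_mul g x y hxy ih =>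
    have hs : g * Equiv.swap a b * g⁻¹ = Equiv.swap (g a) (g b) := by
      rw [Equiv.swap_apply_apply]
    have e : Equiv.swap x y * g * Equiv.swap a b * (Equiv.swap x y * g)⁻¹
        = Equiv.swap x y * Equiv.swap (g a) (g b) * Equiv.swap x y := by
      rw [← hs]; simp [mul_assoc]
    rw [e]
    rw [hs] at ih
    set t := MonoidAlgebra.of k (Equiv.Perm (Fin n)) (Equiv.swap x y) with ht
    set s := MonoidAlgebra.of k (Equiv.Perm (Fin n)) (Equiv.swap (g a) (g b)) with hs'
    have htt : t * t = 1 := by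
      rw [ht, ← map_mul, Equiv.swap_mul_self, map_one]
    have htg : t ∈ gn k n := LieSubalgebra.subset_lieSpan ⟨x, y, hxy, rfl⟩
    have hsg : s ∈ gn k n :=
      LieSubalgebra.subset_lieSpan ⟨g a, g b, fun h => hab (g.injective h), rfl⟩
    have hm : ⁅t, ⁅t, s⁆⁆ ∈ gnDer k n :=
      Submodule.subset_span ⟨t, htg, ⁅t, s⁆, (gn k n).lie_mem htg hsg, rfl⟩
    have hc : ⁅t, ⁅t, s⁆⁆ = (2 : k) • (s - t * s * t) := by
      have h1 : t * (t * s) = s := by rw [← mul_assoc, htt, one_mul]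
      have h2 : s * t * t = s := by rw [mul_assoc, htt, mul_one]
      rw [LieRing.of_associative_ring_bracket, LieRing.of_associative_ring_bracket,
        mul_sub, sub_mul, h1, h2, ← mul_assoc, two_smul]
      abel
    have h3 : s - t * s * t ∈ gnDer k n := by
      have := (gnDer k n).smul_mem (2 : k)⁻¹ hm
      rwa [hc, smul_smul, inv_mul_cancel₀ two_ne_zero, one_smul] at this
    have := add_mem ih h3
    rw [map_mul, map_mul]
    rwa [sub_add_sub_cancel] at this

theorem aux_schur {k V : Type} [Field k] [AddCommGroup V] [Module k V] {n : ℕ}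
    (R : Representation k (Equiv.Perm (Fin n)) V) (h : AbsolutelyIrreducible R)
    (s : Equiv.Perm (Fin n)) :
    ∃ c : k, ∀ v, ∑ g : Equiv.Perm (Fin n), R (g * s * g⁻¹) v = c • v := by
  obtain ⟨c, hc⟩ := h.2.2 (∑ g : Equiv.Perm (Fin n), R (g * s * g⁻¹)) (by
    intro x
    change (∑ g : Equiv.Perm (Fin n), R (g * s * g⁻¹)) * R x =
      R x * (∑ g : Equiv.Perm (Fin n), R (g * s * g⁻¹))
    rw [Finset.sum_mul, Finset.mul_sum]
    symm
    refine Fintype.sum_equiv (Equiv.mulLeft x) _ _ fun g => ?_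
    rw [← map_mul, ← map_mul]
    congr 1
    simp [mul_assoc])
  refine ⟨c, fun v => ?_⟩
  have := LinearMap.congr_fun hc v
  simpa using this

/-- Let `n ≥ 2` and `R₁, R₂` be two absolutely irreducible finite-dimensional
representations of `S_n` of dimension at least 2.  If a linear isomorphism
`P : V₁ → V₂` intertwines the actions of every element of the derived Lie
subalgebra `g'_n ⊆ k[S_n]` (acting through the linear extensions of `R₁, R₂` to
the group algebra), then `P` intertwines the actions of every `s ∈ S_n`; in
particular `R₁` and `R₂` are isomorphic as representations of `S_n`. -/
theorem intertwiner_of_gnDer (k V₁ V₂ : Type) [Field k] [CharZero k]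
    (n : ℕ) (hn : 2 ≤ n)
    [AddCommGroup V₁] [Module k V₁] [FiniteDimensional k V₁]
    [AddCommGroup V₂] [Module k V₂] [FiniteDimensional k V₂]
    (R₁ : Representation k (Equiv.Perm (Fin n)) V₁)
    (R₂ : Representation k (Equiv.Perm (Fin n)) V₂)
    (h₁ : AbsolutelyIrreducible R₁) (h₂ : AbsolutelyIrreducible R₂)
    (hd₁ : 2 ≤ Module.finrank k V₁) (hd₂ : 2 ≤ Module.finrank k V₂)
    (P : V₁ ≃ₗ[k] V₂)
    (hP : ∀ x ∈ gnDer k n,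
      P.toLinearMap ∘ₗ R₁.asAlgebraHom x = R₂.asAlgebraHom x ∘ₗ P.toLinearMap) :
    ∀ s : Equiv.Perm (Fin n),
      P.toLinearMap ∘ₗ (R₁ s) = (R₂ s) ∘ₗ P.toLinearMap := by
  
  have key : ∀ a b : Fin n, a ≠ b → ∀ v,
      P (R₁ (Equiv.swap a b) v) = R₂ (Equiv.swap a b) (P v) := by
    intro a b hab
    obtain ⟨c₁, hc₁⟩ := aux_schur R₁ h₁ (Equiv.swap a b)
    obtain ⟨c₂, hc₂⟩ := aux_schur R₂ h₂ (Equiv.swap a b)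
    have hN : (Fintype.card (Equiv.Perm (Fin n)) : k) ≠ 0 := by
      exact_mod_cast Fintype.card_ne_zero
    set N : k := (Fintype.card (Equiv.Perm (Fin n)) : k) with hNdef
    set s := Equiv.swap a b with hs
    have hdiff : ∀ g : Equiv.Perm (Fin n), ∀ v,
        P (R₁ s v) - P (R₁ (g * s * g⁻¹) v) = R₂ s (P v) - R₂ (g * s * g⁻¹) (P v) := by
      intro g v
      have := LinearMap.congr_fun (hP _ (aux_der k n a b hab g)) v
      simpa only [map_sub, Representation.asAlgebraHom_of, LinearMap.comp_apply,
        LinearMap.sub_apply, LinearEquiv.coe_coe] using this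
    have hsum : ∀ v, N • P (R₁ s v) - c₁ • P v = N • R₂ s (P v) - c₂ • P v := by
      intro v
      have := Finset.sum_congr (rfl : (Finset.univ : Finset (Equiv.Perm (Fin n))) = _)
        (fun g _ => hdiff g v)
      rw [Finset.sum_sub_distrib, Finset.sum_sub_distrib, ← map_sum P (fun g => R₁ (g * s * g⁻¹) v), hc₁, hc₂, map_smul] at this
      simpa [hNdef, Nat.cast_smul_eq_nsmul] using this
    obtain ⟨l, hl⟩ : ∃ l : k, ∀ v, P (R₁ s v) = R₂ s (P v) + l • P v := by
      refine ⟨N⁻¹ * (c₁ - c₂), fun v => ?_⟩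
      have h4 : N • P (R₁ s v) = N • R₂ s (P v) + (c₁ - c₂) • P v := by
        rw [sub_smul]
        have := hsum v
        rw [sub_eq_iff_eq_add] at this
        rw [this]; abel
      calc P (R₁ s v) = N⁻¹ • (N • P (R₁ s v)) := by rw [inv_smul_smul₀ hN]
        _ = _ := by rw [h4, smul_add, inv_smul_smul₀ hN, smul_smul]
    by_cases hl0 : l = 0
    · intro v; rw [hl, hl0, zero_smul, add_zero]
    exfalso
    have hss : s * s = 1 := Equiv.swap_mul_self a b
    have hscal : ∀ w, R₂ s w = (-(l / 2)) • w := by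
      intro w
      obtain ⟨v, rfl⟩ := P.surjective w
      have e1 : R₁ s (R₁ s v) = v := by
        rw [← Module.End.mul_apply, ← map_mul, hss, map_one, Module.End.one_apply]
      have e2 : R₂ s (R₂ s (P v)) = P v := by
        rw [← Module.End.mul_apply, ← map_mul, hss, map_one, Module.End.one_apply]
      have e3 := hl (R₁ s v)
      rw [e1, hl v, map_add, e2, map_smul, smul_add, smul_smul] at e3
      have e4 : (2 * l) • R₂ s (P v) = (-(l * l)) • P v := by
        rw [two_mul, add_smul, neg_smul, eq_neg_iff_add_eq_zero]
        have e5 : P v + (l • R₂ s (P v) + l • R₂ s (P v) + (l * l) • P v) = P v + 0 := by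
          rw [add_zero]
          conv_rhs => rw [e3]
          abel
        exact add_left_cancel e5
      have h2l : (2 * l) ≠ 0 := mul_ne_zero two_ne_zero hl0
      calc R₂ s (P v) = (2 * l)⁻¹ • ((2 * l) • R₂ s (P v)) := by rw [inv_smul_smul₀ h2l]
        _ = _ := by
          rw [e4, smul_smul]
          congr 1
          field_simp
    have hall : ∀ g : Equiv.Perm (Fin n), ∃ c : k, ∀ w, R₂ g w = c • w := by
      intro g
      induction g using Equiv.Perm.swap_induction_on with
      | one => exact ⟨1, by simp⟩
      | swap_mul g x y hxy ih =>
        obtain ⟨c, hc⟩ := ih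
        obtain ⟨u, hu⟩ := isConj_iff.1 (Equiv.Perm.isConj_swap hab hxy)
        refine ⟨c * (-(l / 2)), fun w => ?_⟩
        have e6 : R₂ u (R₂ u⁻¹ w) = w := by
          rw [← Module.End.mul_apply, ← map_mul, mul_inv_cancel, map_one, Module.End.one_apply]
        rw [map_mul, Module.End.mul_apply, hc, map_smul, ← hu, map_mul, map_mul,
          Module.End.mul_apply, Module.End.mul_apply, hscal, map_smul, e6, smul_smul]
    obtain ⟨v, hv⟩ := h₂.1
    rcases h₂.2.1 (Submodule.span k {v}) (by
      intro g w hw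
      obtain ⟨c, hc⟩ := hall g
      rw [hc]
      exact Submodule.smul_mem _ _ hw) with h | h
    · exact hv (Submodule.span_singleton_eq_bot.1 h)
    · have h5 := finrank_span_singleton (K := k) hv
      rw [h, finrank_top] at h5
      omega
  intro s
  induction s using Equiv.Perm.swap_induction_on with
  | one => ext v; simp
  | swap_mul g x y hxy ih =>
    ext v
    have := LinearMap.congr_fun ih v
    simp only [LinearMap.comp_apply, LinearEquiv.coe_coe] at this
    simp [key x y hxy, this]
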